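/- In PG(3,q), every point set K of type (1, q+2, 2q+1)_2 has exactly k = q² + 2q + 1 = (q+1)² points; moreover the number of planes meeting K in 1 point is (q²−q)/2, the number of planes meeting K in q+2 points is q³, and the number of planes meeting K in 2q+1 points is (q²+3q+2)/2. -/

import Mathlib

open Module Set

noncomputable section

variable (F : Type) [Field F]

/-- The point set of `PG(n,q)`: the projectivization of `GF(q)^{n+1}`. -/
abbrev PGPoint (n : ℕ) := Projectivization F (Fin (n + 1) → F)

/-- The set of points of the projective space lying in (the projectivization of)
a linear subspace `W`. A `d`-dimensional projective subspace corresponds to a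
submodule `W` with `finrank F W = d + 1`; hyperplanes correspond to `finrank F W = n`. -/
def projSet (n : ℕ) (W : Submodule F (Fin (n + 1) → F)) : Set (PGPoint F n) :=
  {x | x.submodule ≤ W}

/-- `θ_m = (q^{m+1} - 1)/(q - 1)`, the number of points of `PG(m,q)`. -/
def theta (q m : ℕ) : ℕ := (q ^ (m + 1) - 1) / (q - 1)

/-- `K` is of type `(a,b,c)_{n-1}`: every hyperplane meets `K` in `a`, `b` or `c`
points, and each of the three values is attained by some hyperplane. -/
def IsType3 (n : ℕ) (K : Set (PGPoint F n)) (a b c : ℕ) : Prop :=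
  (∀ W : Submodule F (Fin (n + 1) → F), finrank F W = n →
      (K ∩ projSet F n W).ncard = a ∨ (K ∩ projSet F n W).ncard = b ∨
        (K ∩ projSet F n W).ncard = c) ∧
  (∃ W : Submodule F (Fin (n + 1) → F), finrank F W = n ∧ (K ∩ projSet F n W).ncard = a) ∧
  (∃ W : Submodule F (Fin (n + 1) → F), finrank F W = n ∧ (K ∩ projSet F n W).ncard = b) ∧
  (∃ W : Submodule F (Fin (n + 1) → F), finrank F W = n ∧ (K ∩ projSet F n W).ncard = c)

/-- `tnum K m`: the number of hyperplanes meeting `K` in exactly `m` points. -/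
def tnum (n : ℕ) (K : Set (PGPoint F n)) (m : ℕ) : ℕ :=
  {W : Submodule F (Fin (n + 1) → F) | finrank F W = n ∧ (K ∩ projSet F n W).ncard = m}.ncard


section KerCount

variable {V : Type*} [AddCommGroup V] [Module F V]

open Classical in
/-- The number of points of `K` on the hyperplane `f = 0`. -/
def kerCount (K : Finset (Projectivization F V)) (f : Dual F V) : ℕ :=
  (K.filter fun x => f x.rep = 0).card

lemma kerCount_smul (K : Finset (Projectivization F V)) {a : F} (ha : a ≠ 0) (f : Dual F V) :
    kerCount F K (a • f) = kerCount F K f := by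
  unfold kerCount
  congr 1
  ext x
  simp [ha]

lemma kerCount_le (K : Finset (Projectivization F V)) (f : Dual F V) :
    kerCount F K f ≤ K.card := by
  classical exact Finset.card_filter_le _ _

lemma kerCount_zero (K : Finset (Projectivization F V)) : kerCount F K 0 = K.card := by
  simp [kerCount]

open Classical in
/-- Summing over the hyperplanes `u = 0` and `v + a u = 0` of a pencil: points off the axis are
counted once and points on it `q + 1` times. -/
lemma kerCount_pencil [Fintype F] (K : Finset (Projectivization F V)) (u v : Dual F V) :
    kerCount F K u + ∑ a : F, kerCount F K (v + a • u)
      = K.card + Fintype.card F * (K.filter fun x => u x.rep = 0 ∧ v x.rep = 0).card := by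
  simp only [kerCount, Finset.card_filter]
  rw [Finset.sum_comm, Finset.card_eq_sum_ones, Finset.mul_sum, ← Finset.sum_add_distrib,
    ← Finset.sum_add_distrib]
  refine Finset.sum_congr rfl fun x _ => ?_
  by_cases hu : u x.rep = 0
  · by_cases hv : v x.rep = 0 <;> simp [hu, hv]
  · have : ∀ a : F, v x.rep + a * u x.rep = 0 ↔ a = -v x.rep / u x.rep := by
      intro a
      rw [eq_div_iff hu]
      constructor <;> intro h <;> linear_combination h
    simp [hu, this]

end KerCount

section DualCounting

variable {V : Type*} [AddCommGroup V] [Module F V] [FiniteDimensional F V]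

/-- The functionals vanishing on `W` form a space of size `q ^ codim W`. -/
lemma card_dualAnnihilator [Fintype F] (W : Submodule F V) (d : ℕ)
    (hW : finrank F W + d = finrank F V) :
    Nat.card W.dualAnnihilator = Fintype.card F ^ d := by
  have h := Subspace.finrank_add_finrank_dualAnnihilator_eq W
  rw [Module.natCard_eq_pow_finrank (K := F), Nat.card_eq_fintype_card]
  congr 1
  omega

/-- A nonzero functional vanishes on a hyperplane iff that hyperplane is its kernel. -/
lemma ker_eq_iff_mem_dualAnnihilator {W : Submodule F V} (hW : finrank F W + 1 = finrank F V)
    {f : Dual F V} (hf : f ≠ 0) : LinearMap.ker f = W ↔ f ∈ W.dualAnnihilator := by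
  rw [Submodule.mem_dualAnnihilator]
  constructor
  · rintro rfl w hw
    exact hw
  · intro h
    have := Module.Dual.finrank_ker_add_one_of_ne_zero hf
    exact (Submodule.eq_of_le_of_finrank_eq (fun w hw => h w hw) (by omega)).symm

open Classical in
lemma card_nonzero_ker_eq [Fintype F] [Fintype (Dual F V)] {W : Submodule F V}
    (hW : finrank F W + 1 = finrank F V) :
    (Finset.univ.filter fun f : Dual F V => f ≠ 0 ∧ LinearMap.ker f = W).card
      = Fintype.card F - 1 := by
  have h := card_dualAnnihilator F W 1 hW
  rw [Nat.card_eq_fintype_card, Fintype.card_subtype, pow_one] at h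
  rw [← h, ← Finset.card_erase_of_mem (a := 0) (by simp)]
  congr 1
  ext f
  simp only [Finset.mem_filter, Finset.mem_univ, true_and, Finset.mem_erase]
  exact and_congr_right fun hf => ker_eq_iff_mem_dualAnnihilator F hW hf

open Classical in
/-- Each hyperplane is the kernel of exactly `q - 1` nonzero functionals. -/
lemma card_filter_ker [Fintype F] [Fintype (Dual F V)] (P : Submodule F V → Prop) :
    (Finset.univ.filter fun f : Dual F V => f ≠ 0 ∧ P (LinearMap.ker f)).card
      = {W : Submodule F V | finrank F W + 1 = finrank F V ∧ P W}.ncard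
        * (Fintype.card F - 1) := by
  have hfin : {W : Submodule F V | finrank F W + 1 = finrank F V ∧ P W}.Finite := by
    have : Finite V := Module.finite_of_finite F
    exact Set.toFinite _
  rw [Set.ncard_eq_toFinset_card _ hfin,
    Finset.card_eq_sum_card_fiberwise (f := LinearMap.ker) (t := hfin.toFinset)]
  · apply Finset.sum_const_nat
    intro W hW
    simp only [Set.Finite.mem_toFinset, Set.mem_ofPred_eq] at hW
    rw [← card_nonzero_ker_eq F hW.1, Finset.filter_filter]
    congr 1
    ext f
    simp only [Finset.mem_filter, Finset.mem_univ, true_and]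
    constructor
    · rintro ⟨⟨h0, -⟩, h⟩
      exact ⟨h0, h⟩
    · rintro ⟨h0, rfl⟩
      exact ⟨⟨h0, hW.2⟩, rfl⟩
  · intro f hf
    simp only [Finset.coe_filter, Finset.mem_univ, true_and, Set.mem_ofPred_eq,
      Set.Finite.coe_toFinset] at hf ⊢
    exact ⟨Module.Dual.finrank_ker_add_one_of_ne_zero hf.1, hf.2⟩

open Classical in
lemma card_apply_eq_zero [Fintype F] [Fintype (Dual F V)] {x : V} (hx : x ≠ 0) (d : ℕ)
    (hd : finrank F V = d + 1) :
    (Finset.univ.filter fun f : Dual F V => f x = 0).card = Fintype.card F ^ d := by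
  have h := card_dualAnnihilator F (Submodule.span F {x}) d
    (by rw [finrank_span_singleton hx]; omega)
  rw [Nat.card_eq_fintype_card, Fintype.card_subtype] at h
  rw [← h]
  congr 1
  ext f
  have : f ∈ (Submodule.span F {x}).dualAnnihilator ↔ f x = 0 := by
    rw [← SetLike.mem_coe, Submodule.coe_dualAnnihilator_span]
    simp
  simp only [Finset.mem_filter, Finset.mem_univ, true_and, this]

open Classical in
lemma card_apply_eq_zero_and [Fintype F] [Fintype (Dual F V)] {x y : V}
    (hxy : LinearIndependent F ![x, y]) (d : ℕ) (hd : finrank F V = d + 2) :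
    (Finset.univ.filter fun f : Dual F V => f x = 0 ∧ f y = 0).card = Fintype.card F ^ d := by
  have hr := finrank_span_eq_card hxy
  rw [Fintype.card_fin, Matrix.range_cons, Matrix.range_cons, Matrix.range_empty] at hr
  have h := card_dualAnnihilator F (Submodule.span F ({x} ∪ ({y} ∪ ∅))) d (by omega)
  rw [Nat.card_eq_fintype_card, Fintype.card_subtype] at h
  rw [← h]
  congr 1
  ext f
  have : f ∈ (Submodule.span F ({x} ∪ ({y} ∪ ∅))).dualAnnihilator ↔ f x = 0 ∧ f y = 0 := by
    rw [← SetLike.mem_coe, Submodule.coe_dualAnnihilator_span]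
    simp [Set.subset_def, and_comm]
  simp only [Finset.mem_filter, Finset.mem_univ, true_and, this]

open Classical in
lemma sum_kerCount [Fintype F] [Fintype (Dual F V)] (K : Finset (Projectivization F V)) (d : ℕ)
    (hd : finrank F V = d + 1) :
    ∑ f : Dual F V, kerCount F K f = K.card * Fintype.card F ^ d := by
  simp only [kerCount, Finset.card_filter]
  rw [Finset.sum_comm]
  apply Finset.sum_const_nat
  intro x _
  rw [← Finset.card_filter, card_apply_eq_zero F x.rep_nonzero d hd]

open Classical in
lemma sum_kerCount_sq [Fintype F] [Fintype (Dual F V)] (K : Finset (Projectivization F V)) (d : ℕ)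
    (hd : finrank F V = d + 2) :
    ∑ f : Dual F V, kerCount F K f ^ 2
      = K.card * Fintype.card F ^ (d + 1) + K.card * (K.card - 1) * Fintype.card F ^ d := by
  have h1 : ∀ f : Dual F V, kerCount F K f ^ 2
      = ∑ x ∈ K, ∑ y ∈ K, if f x.rep = 0 ∧ f y.rep = 0 then 1 else 0 := by
    intro f
    simp only [kerCount, Finset.card_filter, sq, Finset.sum_mul_sum]
    refine Finset.sum_congr rfl fun x _ => Finset.sum_congr rfl fun y _ => ?_
    by_cases h : f x.rep = 0 <;> by_cases h' : f y.rep = 0 <;> simp [h, h']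
  simp only [h1]
  rw [Finset.sum_comm, mul_assoc, ← mul_add]
  apply Finset.sum_const_nat
  intro x hx
  rw [Finset.sum_comm, ← Finset.add_sum_erase _ _ hx]
  congr 1
  · rw [← Finset.card_filter]
    simp only [and_self]
    exact card_apply_eq_zero F x.rep_nonzero (d + 1) hd
  · rw [← Finset.card_erase_of_mem hx]
    apply Finset.sum_const_nat
    intro y hy
    rw [← Finset.card_filter]
    refine card_apply_eq_zero_and F ?_ d hd
    rw [← Projectivization.independent_mk_iff_LinearIndependent x.rep_nonzero y.rep_nonzero,
      Projectivization.mk_rep, Projectivization.mk_rep, Projectivization.independent_pair_iff_ne]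
    exact (Finset.ne_of_mem_erase hy).symm

end DualCounting

section Translation

variable {E : Type*} [AddCommGroup E] [Module F E] [Fintype E]

open Classical in
lemma sum_card_translates [Fintype F] (u : E) (P : E → Prop) [DecidablePred P] :
    ∑ v ∈ Finset.univ.filter (fun v : E => v ∉ Submodule.span F {u}),
        (Finset.univ.filter fun a : F => P (v + a • u)).card
      = Fintype.card F
        * (Finset.univ.filter fun w : E => w ∉ Submodule.span F {u} ∧ P w).card := by
  simp only [Finset.card_filter]
  rw [Finset.sum_comm, ← Finset.card_univ]
  apply Finset.sum_const_nat
  intro a _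
  rw [Finset.sum_filter]
  refine Fintype.sum_equiv (Equiv.addRight (a • u)) _ _ fun v => ?_
  have hu : a • u ∈ Submodule.span F {u} :=
    Submodule.smul_mem _ _ (Submodule.mem_span_singleton_self u)
  by_cases h : v ∈ Submodule.span F {u} <;>
    simp [Submodule.add_mem_iff_left _ hu, h]

open Classical in
lemma card_nonzero_mem_span [Fintype F] {u : E} (hu : u ≠ 0) (P : E → Prop) [DecidablePred P]
    (hP : ∀ a : F, a ≠ 0 → (P (a • u) ↔ P u)) :
    (Finset.univ.filter fun w : E => (w ≠ 0 ∧ P w) ∧ w ∈ Submodule.span F {u}).card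
      = (Fintype.card F - 1) * if P u then 1 else 0 := by
  rw [← Finset.card_univ, ← Finset.card_erase_of_mem (Finset.mem_univ (0 : F))]
  have h : (Finset.univ.filter fun w : E => (w ≠ 0 ∧ P w) ∧ w ∈ Submodule.span F {u})
      = ((Finset.univ.erase (0 : F)).filter fun _ => P u).image fun a => a • u := by
    ext w
    simp only [Finset.mem_filter, Finset.mem_univ, true_and, Finset.mem_image, Finset.mem_erase,
      Submodule.mem_span_singleton, and_true]
    constructor
    · rintro ⟨⟨h0, hw⟩, a, rfl⟩
      have ha : a ≠ 0 := by rintro rfl; simp at h0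
      exact ⟨a, ⟨ha, (hP a ha).1 hw⟩, rfl⟩
    · rintro ⟨a, ⟨ha, hw⟩, rfl⟩
      exact ⟨⟨smul_ne_zero ha hu, (hP a ha).2 hw⟩, a, rfl⟩
  rw [h, Finset.card_image_of_injective _ (smul_left_injective F hu)]
  by_cases hPu : P u <;> simp [hPu]

open Classical in
/-- If every pencil through `u` contains `c` members of `P` besides `u` itself, this determines
the number of nonzero vectors satisfying `P`. -/
lemma card_filter_of_pencil [Fintype F] {u : E} (hu : u ≠ 0) (P : E → Prop) [DecidablePred P]
    (hP : ∀ a : F, a ≠ 0 → (P (a • u) ↔ P u)) (d c : ℕ) (hd : finrank F E = d + 1)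
    (hc : ∀ v ∉ Submodule.span F {u},
      (Finset.univ.filter fun a : F => P (v + a • u)).card = c) :
    (Finset.univ.filter fun w : E => w ≠ 0 ∧ P w).card
      = (Fintype.card F ^ d - 1) * c + (Fintype.card F - 1) * if P u then 1 else 0 := by
  rw [← Finset.card_filter_add_card_filter_not (fun w => w ∈ Submodule.span F {u}),
    Finset.filter_filter, Finset.filter_filter, card_nonzero_mem_span F hu P hP, add_comm]
  congr 1
  have hs := sum_card_translates F u P
  have hq : 0 < Fintype.card F := Fintype.card_pos
  have hcard : (Finset.univ.filter (fun v : E => v ∉ Submodule.span F {u})).card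
      = Fintype.card F * (Fintype.card F ^ d - 1) := by
    have h1 : (Finset.univ.filter (fun v : E => v ∈ Submodule.span F {u})).card
        = Fintype.card F := by
      have := Module.natCard_eq_pow_finrank (K := F) (V := Submodule.span F {u})
      rwa [finrank_span_singleton hu, pow_one, Nat.card_eq_fintype_card,
        Nat.card_eq_fintype_card, Fintype.card_subtype] at this
    have h2 : Fintype.card E = Fintype.card F ^ (d + 1) := by
      rw [Module.card_eq_pow_finrank (K := F) (V := E), hd]
    have h3 := Finset.card_filter_add_card_filter_not (s := (Finset.univ : Finset E))
      (fun v => v ∈ Submodule.span F {u})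
    rw [h1, Finset.card_univ, h2] at h3
    rw [Nat.mul_sub, ← pow_succ']
    omega
  rw [Finset.sum_const_nat (m := c) (fun v hv => hc v (by simpa using hv)), hcard] at hs
  rw [Nat.mul_left_cancel hq ((mul_assoc _ _ _).symm.trans hs)]
  refine congrArg Finset.card ?_
  ext w
  simp only [Finset.mem_filter, Finset.mem_univ, true_and]
  constructor
  · rintro ⟨⟨-, h⟩, h'⟩
    exact ⟨h', h⟩
  · rintro ⟨h', h⟩
    exact ⟨⟨by rintro rfl; exact h' (Submodule.zero_mem _), h⟩, h'⟩

end Translation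


/-- The standard equations force `k = (q + 1) ^ 2` when `t₂ = q ^ 3`. -/
lemma three_level_size {q t₁ t₂ t₃ k : ℤ} (hq : 2 ≤ q)
    (h₁ : t₁ + t₂ + t₃ = q ^ 3 + q ^ 2 + q + 1)
    (h₂ : t₁ + (q + 2) * t₂ + (2 * q + 1) * t₃ = k * (q ^ 2 + q + 1))
    (h₃ : t₁ + (q + 2) ^ 2 * t₂ + (2 * q + 1) ^ 2 * t₃
      = k * (q ^ 2 + q + 1) + k * (k - 1) * (q + 1))
    (ht : t₂ = q ^ 3) :
    k = (q + 1) ^ 2 ∧ 2 * t₁ = q ^ 2 - q ∧ 2 * t₃ = q ^ 2 + 3 * q + 2 := by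
  subst ht
  have hf : (k - 1 - q * (q + 2)) * ((q + 1) * (k - 1) - q ^ 3) = 0 := by
    linear_combination (2 * q + 2) * h₂ - (2 * q + 1) * h₁ - h₃
  have hk' : k = (q + 1) ^ 2 := by
    rcases mul_eq_zero.1 hf with h | h
    · linear_combination h
    · have : q + 1 ∣ 1 := ⟨q ^ 2 - q + 1 - (k - 1), by linear_combination h⟩
      have := Int.le_of_dvd one_pos this
      omega
  have hq0 : q ≠ 0 := by omega
  have h3 : 2 * t₃ = q ^ 2 + 3 * q + 2 := by
    apply mul_left_cancel₀ hq0
    subst hk'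
    linear_combination h₂ - h₁
  exact ⟨hk', by linear_combination 2 * h₁ - h3, h3⟩

/-- The standard equations have no solution with `t₂ = q ^ 2 + q + 1` and `k ≡ 2` modulo `q`. -/
lemma not_three_level_of_plane {q t₁ t₂ t₃ k : ℤ} (hq : 2 ≤ q) (hk : 0 ≤ k)
    (h₁ : t₁ + t₂ + t₃ = q ^ 3 + q ^ 2 + q + 1)
    (h₂ : t₁ + (q + 2) * t₂ + (2 * q + 1) * t₃ = k * (q ^ 2 + q + 1))
    (h₃ : t₁ + (q + 2) ^ 2 * t₂ + (2 * q + 1) ^ 2 * t₃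
      = k * (q ^ 2 + q + 1) + k * (k - 1) * (q + 1))
    (ht : t₂ = q ^ 2 + q + 1) (hkq : q ∣ k - 2) : False := by
  subst ht
  have hf : (q + 1) * k ^ 2 - (2 * q ^ 3 + 3 * q ^ 2 + 4 * q + 2) * k
      + (q + 1) * (3 * q ^ 3 + q ^ 2 + 2 * q) = 0 := by
    linear_combination (2 * q + 2) * h₂ - (2 * q + 1) * h₁ - h₃
  obtain ⟨j, rfl⟩ : q + 1 ∣ k :=
    ⟨-k ^ 2 + (2 * q ^ 2 + q + 3) * k - (3 * q ^ 3 + q ^ 2 + 2 * q), by linear_combination hf⟩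
  have hj : (q + 1) ^ 2 * j ^ 2 - (2 * q ^ 3 + 3 * q ^ 2 + 4 * q + 2) * j
      + (3 * q ^ 3 + q ^ 2 + 2 * q) = 0 := by
    apply mul_left_cancel₀ (by omega : q + 1 ≠ 0)
    linear_combination hf
  have hj0 : 0 ≤ j := by
    by_contra! h
    nlinarith
  obtain ⟨i, hi⟩ : q ∣ j - 2 := by
    obtain ⟨m, hm⟩ := hkq
    exact ⟨m - j, by linear_combination hm⟩
  obtain rfl : j = 2 + q * i := by linear_combination hi
  have hi1 : -1 ≤ i := by
    by_contra! h
    nlinarith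
  rcases hi1.eq_or_lt with rfl | hi0
  · have : q = 2 := by omega
    subst this
    norm_num at hj
  rcases (show 0 ≤ i by omega).eq_or_lt with rfl | hi0
  · have : q * (q + 2) * (q - 1) = 0 := by linear_combination -hj
    have : 0 < q * (q + 2) * (q - 1) := by
      have : 0 < q - 1 := by omega
      positivity
    omega
  rcases (show 1 ≤ i by omega).eq_or_lt with rfl | hi0
  · have : q * (q ^ 3 - 2 * q ^ 2 - 4 * q - 4) = 0 := by linear_combination -hj
    rcases mul_eq_zero.1 this with h | h
    · omega
    · rcases lt_or_ge q 4 with h4 | h4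
      · interval_cases q <;> omega
      · nlinarith [mul_nonneg (sq_nonneg q) (sub_nonneg.2 h4)]
  · have h2 : 2 * q + 2 ≤ 2 + q * i := by nlinarith
    have h3 : 0 ≤ (2 + q * i) * ((q + 1) ^ 2 * (2 + q * i - (2 * q + 2))) := by
      have := sub_nonneg.2 h2
      positivity
    have h4 : 0 < (2 + q * i) * (3 * q ^ 2 + 2 * q) := by positivity
    have h5 : 0 < 3 * q ^ 3 + q ^ 2 + 2 * q := by positivity
    nlinarith

lemma eq_of_dvd_sub_of_lt {q x c : ℕ} (hx : 0 < x) (hxq : x < q) (hcq : c ≤ q)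
    (h : (q : ℤ) ∣ x - c) : c = x := by
  obtain ⟨m, hm⟩ := h
  have h1 : m < 1 := by nlinarith
  have h2 : -1 < m := by nlinarith
  obtain rfl : m = 0 := by omega
  omega

section Main

variable {V : Type*} [AddCommGroup V] [Module F V]

open Classical in
/-- The number of members of type `q + 2` in a pencil is congruent to `|K| - 1` modulo `q`. -/
lemma dvd_card_sub_pencil [Fintype F] (K : Finset (Projectivization F V))
    (hK : ∀ f : Dual F V, f ≠ 0 → kerCount F K f = 1 ∨ kerCount F K f = Fintype.card F + 2 ∨
      kerCount F K f = 2 * Fintype.card F + 1)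
    {u v : Dual F V} (hu : u ≠ 0) (hv : v ∉ Submodule.span F {u}) :
    (Fintype.card F : ℤ) ∣ (K.card : ℤ) - 1
      - (if kerCount F K u = Fintype.card F + 2 then 1 else 0)
      - (Finset.univ.filter fun a : F =>
          kerCount F K (v + a • u) = Fintype.card F + 2).card := by
  set q := Fintype.card F with hq
  have hdvd : ∀ f : Dual F V, f ≠ 0 →
      (q : ℤ) ∣ kerCount F K f - 1 - (if kerCount F K f = q + 2 then 1 else 0) := by
    intro f hf
    split_ifs with h
    · exact ⟨1, by rw [h]; push_cast; ring⟩
    · rcases hK f hf with h' | h' | h'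
      · exact ⟨0, by rw [h']; simp⟩
      · exact absurd h' h
      · exact ⟨2, by rw [h']; push_cast; ring⟩
  have hne : ∀ a : F, v + a • u ≠ 0 := by
    intro a ha
    refine hv (Submodule.mem_span_singleton.2 ⟨-a, ?_⟩)
    rw [neg_smul]
    exact (eq_neg_of_add_eq_zero_left ha).symm
  have hsum := dvd_add (hdvd u hu)
    (Finset.dvd_sum fun a (_ : a ∈ (Finset.univ : Finset F)) => hdvd _ (hne a))
  have hp := kerCount_pencil F K u v
  rw [← hq] at hp
  zify at hp
  rw [Finset.sum_sub_distrib, Finset.sum_sub_distrib, Finset.sum_boole, Finset.sum_const,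
    Finset.card_univ, ← hq] at hsum
  obtain ⟨m, hm⟩ := hsum
  refine ⟨m + 1 - (K.filter fun x => u x.rep = 0 ∧ v x.rep = 0).card, ?_⟩
  simp only [nsmul_eq_mul, mul_one] at hm
  linear_combination hm - hp

open Classical in
/-- In vector dimension four, the nonzero functionals of type `q + 2` number `(q - 1) q ^ 3`
or `(q - 1) (q ^ 2 + q + 1)`, according to the residue of `|K|` modulo `q`. -/
lemma card_middle_type [Fintype F] [Fintype (Dual F V)] (hV : finrank F (Dual F V) = 4)
    (K : Finset (Projectivization F V))
    (hK : ∀ f : Dual F V, f ≠ 0 → kerCount F K f = 1 ∨ kerCount F K f = Fintype.card F + 2 ∨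
      kerCount F K f = 2 * Fintype.card F + 1)
    {u₀ u₁ : Dual F V} (hu₀ : u₀ ≠ 0) (hu₁ : u₁ ≠ 0)
    (h₀ : kerCount F K u₀ = Fintype.card F + 2) (h₁ : kerCount F K u₁ ≠ Fintype.card F + 2) :
    ∃ t : ℕ, (Finset.univ.filter fun f : Dual F V =>
        f ≠ 0 ∧ kerCount F K f = Fintype.card F + 2).card = t * (Fintype.card F - 1) ∧
      (t = Fintype.card F ^ 3 ∨
        t = Fintype.card F ^ 2 + Fintype.card F + 1 ∧ (Fintype.card F : ℤ) ∣ K.card - 2) := by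
  have hq2 : 2 ≤ Fintype.card F := Fintype.one_lt_card
  have hcount := fun (u : Dual F V) (hu : u ≠ 0) (c : ℕ) =>
    card_filter_of_pencil F hu (fun f => kerCount F K f = Fintype.card F + 2)
      (fun a ha => by rw [kerCount_smul F K ha]) 3 c hV
  have hdvd₀ := fun v hv => dvd_card_sub_pencil F K hK (u := u₀) (v := v) hu₀ hv
  have hdvd₁ := fun v hv => dvd_card_sub_pencil F K hK (u := u₁) (v := v) hu₁ hv
  have hle : ∀ u v : Dual F V, (Finset.univ.filter fun a : F =>
      kerCount F K (v + a • u) = Fintype.card F + 2).card ≤ Fintype.card F :=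
    fun u v => Finset.card_le_univ _
  have hc₀ := hcount u₀ hu₀
  have hc₁ := hcount u₁ hu₁
  simp only [h₀, h₁, if_true, if_false, mul_one, mul_zero, add_zero, sub_zero] at hdvd₀ hdvd₁ hc₀ hc₁
  clear hcount
  set q := Fintype.card F with hq
  have hgeom : q ^ 3 - 1 = (q ^ 2 + q + 1) * (q - 1) := by
    obtain ⟨p, hp⟩ : ∃ p, q = p + 1 := ⟨q - 1, by omega⟩
    rw [hp, Nat.add_sub_cancel]
    exact Nat.sub_eq_of_eq_add (by ring)
  have hr0 : 0 ≤ ((K.card : ℤ) - 1) % q := Int.emod_nonneg _ (by omega)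
  have hrq : ((K.card : ℤ) - 1) % q < q := Int.emod_lt_of_pos _ (by omega)
  have hrd : (q : ℤ) ∣ (K.card : ℤ) - 1 - ((K.card : ℤ) - 1) % q := Int.dvd_self_sub_emod
  obtain ⟨r, hr⟩ := Int.eq_ofNat_of_zero_le hr0
  rw [hr] at hrq hrd
  by_cases hr' : r = 0
  · subst hr'
    refine ⟨q ^ 3, ?_, Or.inl rfl⟩
    rw [hc₀ (q - 1), ← add_one_mul, Nat.sub_add_cancel (Nat.one_le_pow 3 q (by omega))]
    intro v hv
    refine eq_of_dvd_sub_of_lt (q := q) (by omega) (by omega) (hle u₀ v) ?_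
    obtain ⟨a, ha⟩ := hdvd₀ v hv
    obtain ⟨b, hb⟩ := hrd
    rw [Nat.cast_sub (by omega : 1 ≤ q)]
    push_cast at hb ⊢
    exact ⟨a - b + 1, by linear_combination ha - hb⟩
  have h1 : ∀ v ∉ Submodule.span F {u₁}, (Finset.univ.filter fun a : F =>
      kerCount F K (v + a • u₁) = q + 2).card = r := by
    intro v hv
    refine eq_of_dvd_sub_of_lt (q := q) (by omega) (by omega) (hle u₁ v) ?_
    obtain ⟨a, ha⟩ := hdvd₁ v hv
    obtain ⟨b, hb⟩ := hrd
    exact ⟨a - b, by linear_combination ha - hb⟩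
  have hc₁ := hc₁ r h1
  by_cases hr1 : r = 1
  · subst hr1
    refine ⟨q ^ 2 + q + 1, by rw [hc₁, mul_one, hgeom], Or.inr ⟨rfl, ?_⟩⟩
    convert hrd using 1
    push_cast
    ring
  · exfalso
    have hc₀ := hc₀ (r - 1) ?_
    · rw [hc₁] at hc₀
      obtain ⟨s, rfl⟩ : ∃ s, r = s + 1 := ⟨r - 1, by omega⟩
      rw [Nat.add_sub_cancel, mul_add_one, hgeom] at hc₀
      have := Nat.add_left_cancel hc₀
      have hpos : 0 < q - 1 := by omega
      nlinarith
    · intro v hv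
      refine eq_of_dvd_sub_of_lt (q := q) (by omega) (by omega) (hle u₀ v) ?_
      obtain ⟨a, ha⟩ := hdvd₀ v hv
      obtain ⟨b, hb⟩ := hrd
      rw [Nat.cast_sub (by omega : 1 ≤ r)]
      push_cast
      exact ⟨a - b, by linear_combination ha - hb⟩

end Main

open Classical in
lemma ncard_inter_projSet_ker [Fintype F] (n : ℕ) (K : Set (PGPoint F n)) (hK : K.Finite)
    (f : Dual F (Fin (n + 1) → F)) :
    (K ∩ projSet F n (LinearMap.ker f)).ncard = kerCount F hK.toFinset f := by
  rw [kerCount, ← Set.ncard_coe_finset]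
  congr 1
  ext x
  simp [projSet, Projectivization.submodule_eq]

open Classical in
lemma tnum_mul [Fintype F] [Fintype (Dual F (Fin 4 → F))] (K : Set (PGPoint F 3))
    (hK : K.Finite) (m : ℕ) :
    (Finset.univ.filter fun f : Dual F (Fin 4 → F) =>
        f ≠ 0 ∧ kerCount F hK.toFinset f = m).card = tnum F 3 K m * (Fintype.card F - 1) := by
  have h := card_filter_ker F (V := Fin 4 → F)
    (fun W => (K ∩ projSet F 3 W).ncard = m)
  simp only [ncard_inter_projSet_ker F 3 K hK] at h
  rw [h]
  simp [tnum]

/-- A hyperplane is the kernel of a nonzero functional. -/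
lemma exists_ker_eq {n : ℕ} {W : Submodule F (Fin (n + 1) → F)} (hW : finrank F W = n) :
    ∃ f : Dual F (Fin (n + 1) → F), f ≠ 0 ∧ LinearMap.ker f = W := by
  have hr := Subspace.finrank_add_finrank_dualAnnihilator_eq W
  rw [hW, finrank_fin_fun] at hr
  have : W.dualAnnihilator ≠ ⊥ := by
    intro h
    rw [h, finrank_bot] at hr
    omega
  obtain ⟨f, hf, h0⟩ := Submodule.exists_mem_ne_zero_of_ne_bot this
  exact ⟨f, h0, (ker_eq_iff_mem_dualAnnihilator F (by rw [hW, finrank_fin_fun]) h0).2 hf⟩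

open Classical in
lemma sum_over_types {ι R : Type*} [CommRing R] (s : Finset ι) (N : ι → ℕ) (φ : ℕ → R)
    {a b c : ℕ} (hab : a ≠ b) (hac : a ≠ c) (hbc : b ≠ c)
    (h : ∀ i ∈ s, N i = a ∨ N i = b ∨ N i = c) :
    ∑ i ∈ s, φ (N i) = (s.filter fun i => N i = a).card * φ a
      + (s.filter fun i => N i = b).card * φ b + (s.filter fun i => N i = c).card * φ c := by
  simp only [← Finset.sum_boole, Finset.sum_mul, ← Finset.sum_add_distrib]
  refine Finset.sum_congr rfl fun i hi => ?_
  rcases h i hi with h | h | h <;> simp [h, hab, hac, hbc, hab.symm, hac.symm, hbc.symm]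

/-- In `PG(3,q)`, every point set of type `(1, q+2, 2q+1)_2` has exactly
`k = q² + 2q + 1 = (q+1)²` points; moreover `t_1 = (q²-q)/2`, `t_{q+2} = q³` and
`t_{2q+1} = (q²+3q+2)/2`. -/
theorem statement14 [Fintype F] (q : ℕ) (hq : Fintype.card F = q)
    (K : Set (PGPoint F 3)) (hK : IsType3 F 3 K 1 (q + 2) (2 * q + 1)) :
    K.ncard = q ^ 2 + 2 * q + 1 ∧ K.ncard = (q + 1) ^ 2 ∧
    tnum F 3 K 1 = (q ^ 2 - q) / 2 ∧
    tnum F 3 K (q + 2) = q ^ 3 ∧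
    tnum F 3 K (2 * q + 1) = (q ^ 2 + 3 * q + 2) / 2 := by
  classical
  subst hq
  have hfin : K.Finite := Set.toFinite K
  have : Finite (Dual F (Fin 4 → F)) := Module.finite_of_finite F
  let _ : Fintype (Dual F (Fin 4 → F)) := Fintype.ofFinite _
  have hV : finrank F (Fin 4 → F) = 4 := finrank_fin_fun F
  have hV' : finrank F (Dual F (Fin 4 → F)) = 4 := by rw [Subspace.dual_finrank_eq, hV]
  have hq2 : 2 ≤ Fintype.card F := Fintype.one_lt_card
  have hN := ncard_inter_projSet_ker F 3 K hfin
  have htnum := tnum_mul F K hfin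
  have hcardK : K.ncard = hfin.toFinset.card := Set.ncard_eq_toFinset_card K hfin
  obtain ⟨hall, ⟨W₁, hW₁, h₁⟩, ⟨W₀, hW₀, h₀⟩, -⟩ := hK
  obtain ⟨u₁, hu₁, rfl⟩ := exists_ker_eq F hW₁
  obtain ⟨u₀, hu₀, rfl⟩ := exists_ker_eq F hW₀
  rw [hN] at h₀ h₁
  have htype : ∀ f : Dual F (Fin 4 → F), f ≠ 0 → kerCount F hfin.toFinset f = 1 ∨
      kerCount F hfin.toFinset f = Fintype.card F + 2 ∨
      kerCount F hfin.toFinset f = 2 * Fintype.card F + 1 := by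
    intro f hf
    rw [← hN]
    refine hall _ ?_
    have := Module.Dual.finrank_ker_add_one_of_ne_zero hf
    rw [hV] at this
    exact Nat.add_right_cancel this
  obtain ⟨t, ht, ht'⟩ := card_middle_type F hV' hfin.toFinset htype hu₀ hu₁ h₀ (by omega)
  have hs₁ := sum_kerCount F hfin.toFinset 3 hV
  have hs₂ := sum_kerCount_sq F hfin.toFinset 2 hV
  have hE : Fintype.card (Dual F (Fin 4 → F)) = Fintype.card F ^ 4 := by
    rw [Module.card_eq_pow_finrank (K := F) (V := Dual F (Fin 4 → F)), hV']
  have hsum := fun φ : ℕ → ℤ => sum_over_types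
    (Finset.univ.filter fun f : Dual F (Fin 4 → F) => f ≠ 0)
    (kerCount F hfin.toFinset) φ (a := 1) (b := Fintype.card F + 2) (c := 2 * Fintype.card F + 1)
    (by omega) (by omega) (by omega) (fun f hf => htype f (by simpa using hf))
  have hsplit : ∀ φ : ℕ → ℤ, ∑ f : Dual F (Fin 4 → F) with f ≠ 0, φ (kerCount F hfin.toFinset f)
      = ∑ f, φ (kerCount F hfin.toFinset f) - φ hfin.toFinset.card := by
    intro φ
    rw [Finset.filter_ne' Finset.univ (0 : Dual F (Fin 4 → F)),
      ← Finset.sum_erase_add _ _ (Finset.mem_univ (0 : Dual F (Fin 4 → F))), kerCount_zero]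
    ring
  simp only [Finset.filter_filter, htnum, hsplit] at hsum
  replace ht : tnum F 3 K (Fintype.card F + 2) * (Fintype.card F - 1)
      = t * (Fintype.card F - 1) := by
    refine (htnum _).symm.trans (Eq.trans ?_ ht)
    congr!
  have ht := Nat.mul_right_cancel (by omega) ht
  have hKpos : 1 ≤ K.ncard := by
    rw [hcardK, ← h₁]
    exact kerCount_le F hfin.toFinset u₁
  simp only [← hcardK] at hs₁ hs₂ hsum ht'
  have e₀ := hsum fun _ => 1
  have e₁ := hsum fun n => (n : ℤ)
  have e₂ := hsum fun n => (n : ℤ) ^ 2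
  zify at hs₁ hs₂
  rw [hs₁] at e₁
  rw [hs₂] at e₂
  rw [Finset.sum_const, Finset.card_univ, hE] at e₀
  push_cast [Nat.cast_sub (by omega : 1 ≤ Fintype.card F), Nat.cast_sub hKpos, nsmul_eq_mul]
    at e₀ e₁ e₂
  set q := Fintype.card F
  have hq1 : (q : ℤ) - 1 ≠ 0 := by omega
  have E₁ : (tnum F 3 K 1 : ℤ) + tnum F 3 K (q + 2) + tnum F 3 K (2 * q + 1)
      = q ^ 3 + q ^ 2 + q + 1 := by
    apply mul_left_cancel₀ hq1
    linear_combination -e₀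
  have E₂ : (tnum F 3 K 1 : ℤ) + (q + 2) * tnum F 3 K (q + 2)
      + (2 * q + 1) * tnum F 3 K (2 * q + 1) = K.ncard * (q ^ 2 + q + 1) := by
    apply mul_left_cancel₀ hq1
    linear_combination -e₁
  have E₃ : (tnum F 3 K 1 : ℤ) + (q + 2) ^ 2 * tnum F 3 K (q + 2)
      + (2 * q + 1) ^ 2 * tnum F 3 K (2 * q + 1)
      = K.ncard * (q ^ 2 + q + 1) + K.ncard * (K.ncard - 1) * (q + 1) := by
    apply mul_left_cancel₀ hq1
    linear_combination -e₂
  subst ht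
  rcases ht' with ht' | ⟨ht', hd⟩
  · obtain ⟨h1, h2, h3⟩ := three_level_size (by omega) E₁ E₂ E₃ (by exact_mod_cast ht')
    have hk : K.ncard = (q + 1) ^ 2 := by exact_mod_cast h1
    have h3 : 2 * tnum F 3 K (2 * q + 1) = q ^ 2 + 3 * q + 2 := by exact_mod_cast h3
    have h2 : 2 * tnum F 3 K 1 + q = q ^ 2 := by zify; linear_combination h2
    exact ⟨by rw [hk]; ring, hk, by omega, ht', by omega⟩
  · exact (not_three_level_of_plane (by omega) (by omega) E₁ E₂ E₃ (by exact_mod_cast ht') hd).elim
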